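/- (Theorem 1, sufficiency, interval form.) Let z and w be complex numbers such that Re(z)·Re(w) < 0 and Im(z)·Im(w) < 0 (i.e., z lies in the opposite diagonal quadrant of w). Then the rotation angle Δφ = arg z − arg w lies, modulo 2π, in the open interval (π/2, 3π/2): there exists an integer k such that π/2 < arg z − arg w + 2·π·k < 3·π/2. -/

import Mathlib

/-- A real number with negative cosine lies in `(π/2, 3π/2)` modulo `2π`. -/
theorem Real.exists_int_mem_Ioo_of_cos_neg {x : ℝ} (hx : Real.cos x < 0) :
    ∃ k : ℤ, x + 2 * Real.pi * k ∈ Set.Ioo (Real.pi / 2) (3 * Real.pi / 2) := by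
  obtain ⟨k, ⟨hl, hu⟩, -⟩ :=
    existsUnique_add_zsmul_mem_Ico Real.two_pi_pos x (-(Real.pi / 2))
  have hk : x + k • (2 * Real.pi) = x + 2 * Real.pi * k := by
    rw [zsmul_eq_mul, mul_comm (k : ℝ)]
  rw [hk] at hl hu
  refine ⟨k, ?_, by linarith⟩
  by_contra! h
  have hcos := Real.cos_nonneg_of_mem_Icc ⟨hl, h⟩
  rw [mul_comm, Real.cos_add_int_mul_two_pi] at hcos
  exact hx.not_ge hcos

/-- The polar form of the real inner product of two complex numbers. -/
theorem Complex.norm_mul_norm_mul_cos_arg_sub (z w : ℂ) :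
    ‖z‖ * ‖w‖ * Real.cos (z.arg - w.arg) = z.re * w.re + z.im * w.im := by
  rw [Real.cos_sub, ← Complex.norm_mul_cos_arg z, ← Complex.norm_mul_cos_arg w,
    ← Complex.norm_mul_sin_arg z, ← Complex.norm_mul_sin_arg w]
  ring

/-- Theorem 1 (sufficiency, interval form): if `z` lies in the opposite diagonal quadrant
of `w` (i.e. `Re z · Re w < 0` and `Im z · Im w < 0`), then the rotation angle
`Δφ = arg z − arg w` lies, modulo `2π`, in the open interval `(π/2, 3π/2)`. -/
theorem opposite_diagonal_quadrant_angle_interval (z w : ℂ)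
    (hre : z.re * w.re < 0) (him : z.im * w.im < 0) :
    ∃ k : ℤ, Real.pi / 2 < z.arg - w.arg + 2 * Real.pi * k ∧
      z.arg - w.arg + 2 * Real.pi * k < 3 * Real.pi / 2 := by
  refine Real.exists_int_mem_Ioo_of_cos_neg (lt_of_not_ge fun h => ?_)
  have hnonneg := mul_nonneg (mul_nonneg (norm_nonneg z) (norm_nonneg w)) h
  rw [Complex.norm_mul_norm_mul_cos_arg_sub] at hnonneg
  linarith
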